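/- arXiv:2009.02953 — 2 statements merged into one kernel-verified Lean document; each statement's English description precedes it below -/
import Mathlib

section
/- For every graph G, every positive integer p, and every graph H such that some (≤ p-1)-subdivision of H is isomorphic to a subgraph of G (i.e., H ∈ TM_{p-1}(G)), one has χ(H) ≤ χ_p(G)^p. Equivalently, χ_p(G) ≥ χ(TM_{p-1}(G))^{1/p}. -/
open SimpleGraph

/-! ## Basic containment relations between graphs -/

/-- `H` is isomorphic to a (not necessarily induced) subgraph of `G`. -/
def IsSubgraphOf {V W : Type*} (H : SimpleGraph V) (G : SimpleGraph W) : Prop :=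
  ∃ f : H →g G, Function.Injective f

/-- `H` is isomorphic to an induced subgraph of `G`. -/
def IsInducedSubgraphOf {V W : Type*} (H : SimpleGraph V) (G : SimpleGraph W) : Prop :=
  Nonempty (H ↪g G)

/-- The clique number `ω(G)`: the largest `m` such that `K_m` is a subgraph of `G`. -/
noncomputable def omegaNum {V : Type*} (G : SimpleGraph V) : ℕ :=
  sSup {m | IsSubgraphOf (⊤ : SimpleGraph (Fin m)) G}

/-- The chromatic number `χ(G)` (as a natural number). -/
noncomputable def chi {V : Type*} (G : SimpleGraph V) : ℕ :=
  sInf {N | G.Colorable N}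

/-! ## Tree-depth and the invariants `χ_p` -/

/-- A forest order: a partial order in which the down-set of every element is a chain.
Such orders are exactly the ancestor orders of rooted forests. -/
def IsForestOrder {V : Type*} (r : V → V → Prop) : Prop :=
  (∀ v, r v v) ∧ (∀ u v, r u v → r v u → u = v) ∧
  (∀ u v w, r u v → r v w → r u w) ∧
  (∀ u v w, r u w → r v w → r u v ∨ r v u)

/-- `G` has tree-depth at most `h`: `G` is a subgraph of the closure of a rooted forest
of height at most `h` (height = maximum number of vertices on a root-to-leaf path). -/
def TreeDepthLE {V : Type*} (G : SimpleGraph V) (h : ℕ) : Prop :=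
  ∃ r : V → V → Prop, IsForestOrder r ∧
    (∀ u v, G.Adj u v → r u v ∨ r v u) ∧
    (∀ v, {u | r u v}.ncard ≤ h)

/-- The tree-depth `td(G)`. -/
noncomputable def treeDepth {V : Type*} (G : SimpleGraph V) : ℕ :=
  sInf {h | TreeDepthLE G h}

/-- `χ_p(G)`: the least number of colors of a vertex coloring such that every set `I` of at
most `p` colors induces a subgraph of tree-depth at most `|I|`. -/
noncomputable def chiP {V : Type*} (G : SimpleGraph V) (p : ℕ) : ℕ :=
  sInf {N | ∃ c : V → Fin N, ∀ I : Finset (Fin N), I.card ≤ p →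
    TreeDepthLE (G.induce {v | c v ∈ I}) I.card}

/-! ## Star colorings -/

/-- A star coloring: a proper coloring with no path on `4` vertices using only two colors. -/
def IsStarColoring {V α : Type*} (G : SimpleGraph V) (c : V → α) : Prop :=
  (∀ u v, G.Adj u v → c u ≠ c v) ∧
  ∀ x y z w : V, G.Adj x y → G.Adj y z → G.Adj z w →
    x ≠ z → y ≠ w → x ≠ w → ¬(c x = c z ∧ c y = c w)

/-- The star chromatic number `χ_s(G)`. -/
noncomputable def starChi {V : Type*} (G : SimpleGraph V) : ℕ :=
  sInf {N | ∃ c : V → Fin N, IsStarColoring G c}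

/-! ## Subdivisions -/

/-- The edges of a graph on `Fin n`, presented as increasingly ordered pairs. -/
def Edges {n : ℕ} (H : SimpleGraph (Fin n)) : Type :=
  {p : Fin n × Fin n // p.1 < p.2 ∧ H.Adj p.1 p.2}

/-- Base relation of the subdivision of `H`, where the edge `e` receives `t e` internal
vertices. -/
def subdivRel {n : ℕ} (H : SimpleGraph (Fin n)) (t : Edges H → ℕ) :
    (Fin n ⊕ Σ e : Edges H, Fin (t e)) → (Fin n ⊕ Σ e : Edges H, Fin (t e)) → Prop
  | Sum.inl u, Sum.inl v => ∃ h : u < v ∧ H.Adj u v, t ⟨(u, v), h⟩ = 0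
  | Sum.inl u, Sum.inr ⟨e, i⟩ =>
      (u = e.1.1 ∧ (i : ℕ) = 0) ∨ (u = e.1.2 ∧ (i : ℕ) + 1 = t e)
  | Sum.inr ⟨e, i⟩, Sum.inr ⟨e', j⟩ => e = e' ∧ (i : ℕ) + 1 = (j : ℕ)
  | _, _ => False

/-- The subdivision of `H` in which each edge `e` is replaced by a path with exactly `t e`
internal vertices. In particular `Subdiv H (fun _ => r)` is the `r`-subdivision `H^{(r)}`,
and the `(≤ r)`-subdivisions of `H` are the graphs `Subdiv H t` with `t e ≤ r` for all `e`. -/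
def Subdiv {n : ℕ} (H : SimpleGraph (Fin n)) (t : Edges H → ℕ) :
    SimpleGraph (Fin n ⊕ Σ e : Edges H, Fin (t e)) :=
  SimpleGraph.fromRel (subdivRel H t)

/-- `H ∈ TM_r(G)`: some `(≤ r)`-subdivision of `H` is a subgraph of `G`. -/
def MemTM {W : Type*} (r : ℕ) (G : SimpleGraph W) {n : ℕ} (H : SimpleGraph (Fin n)) : Prop :=
  ∃ t : Edges H → ℕ, (∀ e, t e ≤ r) ∧ IsSubgraphOf (Subdiv H t) G

/-- `H ∈ ITM_r^e(G)`: the exact `r`-subdivision of `H` is an induced subgraph of `G`. -/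
def MemITM {W : Type*} (r : ℕ) (G : SimpleGraph W) {n : ℕ} (H : SimpleGraph (Fin n)) : Prop :=
  IsInducedSubgraphOf (Subdiv H (fun _ => r)) G

/-- `ω(TM_r(G))`: the supremum of the clique numbers of the graphs in `TM_r(G)`. -/
noncomputable def omegaTM {W : Type*} (r : ℕ) (G : SimpleGraph W) : ℕ :=
  sSup {m | ∃ (k : ℕ) (H : SimpleGraph (Fin k)), MemTM r G H ∧ omegaNum H = m}

/-- The biclique number `bω(G)`: the largest `s` with `K_{s,s}` a subgraph of `G`. -/
noncomputable def bomega {V : Type*} (G : SimpleGraph V) : ℕ :=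
  sSup {s | IsSubgraphOf (completeBipartiteGraph (Fin s) (Fin s)) G}

/-- The average degree `d̄(G) = 2|E(G)|/|V(G)|`. -/
noncomputable def avgDeg {n : ℕ} (G : SimpleGraph (Fin n)) : ℝ :=
  2 * (G.edgeSet.ncard : ℝ) / n

/-! ## Classes of graphs -/

/-- A class of (finite, simple) graphs: for each `n`, a set of graphs on `Fin n`.
Classes are implicitly closed under isomorphism via the relations used below. -/
def GraphClass := ∀ n : ℕ, Set (SimpleGraph (Fin n))

/-- A hereditary class: closed under induced subgraphs (hence under isomorphism). -/
def Hereditary (C : GraphClass) : Prop :=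
  ∀ ⦃n m : ℕ⦄ (G : SimpleGraph (Fin n)) (H : SimpleGraph (Fin m)),
    G ∈ C n → IsInducedSubgraphOf H G → H ∈ C m

/-- A monotone class: closed under subgraphs (hence under isomorphism). -/
def MonotoneClass (C : GraphClass) : Prop :=
  ∀ ⦃n m : ℕ⦄ (G : SimpleGraph (Fin n)) (H : SimpleGraph (Fin m)),
    G ∈ C n → IsSubgraphOf H G → H ∈ C m

/-- `H ∈ TM_r(𝒞)`. -/
def MemTMClass (r : ℕ) (C : GraphClass) {m : ℕ} (H : SimpleGraph (Fin m)) : Prop :=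
  ∃ (n : ℕ) (G : SimpleGraph (Fin n)), G ∈ C n ∧ MemTM r G H

/-- `H ∈ ITM_r^e(𝒞)`. -/
def MemITMClass (r : ℕ) (C : GraphClass) {m : ℕ} (H : SimpleGraph (Fin m)) : Prop :=
  ∃ (n : ℕ) (G : SimpleGraph (Fin n)), G ∈ C n ∧ MemITM r G H

/-- `𝒞` is `χ`-bounded: `χ(H) ≤ f(ω(H))` for every induced subgraph `H` of a graph of `𝒞`. -/
def ChiBounded (C : GraphClass) : Prop :=
  ∃ f : ℕ → ℕ, ∀ ⦃n : ℕ⦄ (G : SimpleGraph (Fin n)), G ∈ C n →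
    ∀ ⦃m : ℕ⦄ (H : SimpleGraph (Fin m)), IsInducedSubgraphOf H G →
      chi H ≤ f (omegaNum H)

/-- `𝒞` has bounded expansion: for every `r`, `d̄(TM_r(𝒞)) < ∞`. -/
def BoundedExpansion (C : GraphClass) : Prop :=
  ∀ r : ℕ, ∃ d : ℝ, ∀ ⦃m : ℕ⦄ (H : SimpleGraph (Fin m)), MemTMClass r C H → avgDeg H ≤ d

/-- `𝒞` has `ω`-bounded expansion. -/
def OmegaBoundedExpansion (C : GraphClass) : Prop :=
  ∃ f : ℕ → ℕ → ℝ, ∀ ⦃n : ℕ⦄ (G : SimpleGraph (Fin n)), G ∈ C n →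
    ∀ (r : ℕ) ⦃m : ℕ⦄ (H : SimpleGraph (Fin m)), MemTM r G H →
      avgDeg H ≤ f (omegaNum G) r

/-- `𝒞` is nowhere dense: for every `r`, `ω(TM_r(𝒞)) < ∞`. -/
def NowhereDense (C : GraphClass) : Prop :=
  ∀ r : ℕ, ∃ c : ℕ, ∀ ⦃m : ℕ⦄ (H : SimpleGraph (Fin m)), MemTMClass r C H → omegaNum H ≤ c

/-- `𝒞` is strongly `χ_p`-bounded: `χ_p(G) ≤ f_p(ω(G))` on `𝒞`. -/
def StronglyChiPBounded (C : GraphClass) (p : ℕ) : Prop :=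
  ∃ f : ℕ → ℕ, ∀ ⦃n : ℕ⦄ (G : SimpleGraph (Fin n)), G ∈ C n → chiP G p ≤ f (omegaNum G)

/-- `𝒞` is weakly `χ_p`-bounded: `χ_p(G) ≤ g_p(ω(TM_{p-1}(G)))` on `𝒞`. -/
def WeaklyChiPBounded (C : GraphClass) (p : ℕ) : Prop :=
  ∃ g : ℕ → ℕ, ∀ ⦃n : ℕ⦄ (G : SimpleGraph (Fin n)), G ∈ C n → chiP G p ≤ g (omegaTM (p - 1) G)

/-! ## Directed graphs, orientations and restricted dualities -/

/-- Existence of a homomorphism between directed graphs presented as binary relations. -/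
def DigraphHomEx {n m : ℕ} (A : Fin n → Fin n → Prop) (B : Fin m → Fin m → Prop) : Prop :=
  ∃ f : Fin n → Fin m, ∀ u v, A u v → B (f u) (f v)

/-- `A` is an orientation of the graph `G`. -/
def IsOrientationOf {n : ℕ} (A : Fin n → Fin n → Prop) (G : SimpleGraph (Fin n)) : Prop :=
  (∀ u v, ¬(A u v ∧ A v u)) ∧ (∀ u v, G.Adj u v ↔ (A u v ∨ A v u))

/-- A directed graph is acyclic if it has no directed cycle. -/
def IsAcyclicDigraph {n : ℕ} (A : Fin n → Fin n → Prop) : Prop :=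
  ∀ v, ¬ Relation.TransGen A v v

/-- The directed graph `F` has a restricted dual for the class of all orientations of the
graphs of `𝒞`. -/
def HasRestrictedDualForOrientations (C : GraphClass) {nF : ℕ}
    (F : Fin nF → Fin nF → Prop) : Prop :=
  ∃ (m : ℕ) (D : Fin m → Fin m → Prop),
    ¬ DigraphHomEx F D ∧
    ∀ ⦃n : ℕ⦄ (A : Fin n → Fin n → Prop) (G : SimpleGraph (Fin n)),
      G ∈ C n → IsOrientationOf A G →
      (¬ DigraphHomEx F A ↔ DigraphHomEx A D)

/-! ## Holes -/

/-- The number `h_g(G)` of holes of length `g` in `G`, i.e. of vertex subsets inducing a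
cycle on `g` vertices. -/
noncomputable def holeCount {n : ℕ} (g : ℕ) (G : SimpleGraph (Fin n)) : ℕ :=
  {S : Set (Fin n) | Nonempty (G.induce S ≃g SimpleGraph.cycleGraph g)}.ncard

/-- `G` is even hole-free: it has no induced cycle of even length at least `4`. -/
def EvenHoleFree {n : ℕ} (G : SimpleGraph (Fin n)) : Prop :=
  ∀ g : ℕ, 4 ≤ g → Even g → holeCount g G = 0

/-! ## Colorings from degeneracy -/

/-- A graph in which every nonempty vertex set contains a vertex with at most `D` neighbors in
the set is `(D + 1)`-colorable. -/
theorem colorable_of_degenerate {V : Type*} [Fintype V] [DecidableEq V] (H : SimpleGraph V)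
    [DecidableRel H.Adj] (D : ℕ)
    (h : ∀ S : Finset V, S.Nonempty → ∃ v ∈ S, (S.filter (H.Adj v)).card ≤ D) :
    H.Colorable (D + 1) := by
  have key : ∀ S : Finset V, ∃ d : V → Fin (D + 1),
      ∀ u ∈ S, ∀ v ∈ S, H.Adj u v → d u ≠ d v := by
    intro S
    induction hn : S.card generalizing S with
    | zero =>
      rw [Finset.card_eq_zero] at hn
      exact ⟨fun _ => 0, by simp [hn]⟩
    | succ n ih =>
      obtain ⟨v, hv, hd⟩ := h S (Finset.card_pos.mp (by omega))
      obtain ⟨d, hd'⟩ := ih (S.erase v) (by rw [Finset.card_erase_of_mem hv]; omega)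
      obtain ⟨a, ha⟩ : ∃ a, a ∉ (S.filter (H.Adj v)).image d := by
        by_contra! hcon
        have h1 := Finset.card_le_card (fun a _ => hcon a :
          (Finset.univ : Finset (Fin (D + 1))) ⊆ (S.filter (H.Adj v)).image d)
        rw [Finset.card_univ, Fintype.card_fin] at h1
        have h2 := Finset.card_image_le (s := S.filter (H.Adj v)) (f := d)
        omega
      have ha' : ∀ w ∈ S, H.Adj v w → d w ≠ a := fun w hw hvw hc =>
        ha (Finset.mem_image.mpr ⟨w, Finset.mem_filter.mpr ⟨hw, hvw⟩, hc⟩)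
      refine ⟨Function.update d v a, fun u hu w hw huw => ?_⟩
      by_cases huv : u = v
      · subst huv
        have hwu : w ≠ u := huw.ne'
        simpa [Function.update_of_ne hwu] using (ha' w hw huw).symm
      · by_cases hwv : w = v
        · subst hwv
          simpa [Function.update_of_ne huv] using ha' u hu huw.symm
        · simpa [Function.update_of_ne huv, Function.update_of_ne hwv] using
            hd' u (by simp [huv, hu]) w (by simp [hwv, hw]) huw
  obtain ⟨d, hd⟩ := key Finset.univ
  exact ⟨SimpleGraph.Coloring.mk d fun {u v} huv => hd u (by simp) v (by simp) huv⟩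

/-- If every edge is covered by the relation `A`, or by `B` in one of its two directions, then
the graph is colorable with one color more than the maximum of `A`-outdegree plus twice
`B`-outdegree. -/
theorem colorable_of_outdegree {V : Type*} [Fintype V] [DecidableEq V] (H : SimpleGraph V)
    (A B : V → V → Prop) [DecidableRel A] [DecidableRel B] (D : ℕ)
    (hAB : ∀ u v, H.Adj u v → A u v ∨ B u v ∨ B v u)
    (hD : ∀ u, (Finset.univ.filter (A u)).card + 2 * (Finset.univ.filter (B u)).card ≤ D) :
    H.Colorable (D + 1) := by
  classical
  refine colorable_of_degenerate H D fun S hS => ?_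
  have hswap : ∑ u ∈ S, (S.filter fun v => B v u).card = ∑ u ∈ S, (S.filter (B u)).card := by
    simp only [Finset.card_filter]
    exact Finset.sum_comm
  refine Finset.exists_le_of_sum_le hS (f := fun v => (S.filter (H.Adj v)).card)
    (g := fun _ => D) ?_
  calc ∑ u ∈ S, (S.filter (H.Adj u)).card
      ≤ ∑ u ∈ S, ((S.filter (A u)).card + ((S.filter (B u)).card
          + (S.filter fun v => B v u).card)) := by
        refine Finset.sum_le_sum fun u _ => ?_
        refine (Finset.card_le_card (t := S.filter (A u) ∪ (S.filter (B u) ∪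
          S.filter fun v => B v u)) fun v hv => ?_).trans ((Finset.card_union_le _ _).trans
            (Nat.add_le_add_left (Finset.card_union_le _ _) _))
        have := hAB u v (Finset.mem_filter.mp hv).2
        have hvS := (Finset.mem_filter.mp hv).1
        simp only [Finset.mem_union, Finset.mem_filter]
        tauto
    _ = ∑ u ∈ S, ((S.filter (A u)).card + 2 * (S.filter (B u)).card) := by
        simp only [Finset.sum_add_distrib, hswap, ← Finset.mul_sum]
        ring
    _ ≤ ∑ u ∈ S, D := by
        refine Finset.sum_le_sum fun u _ => le_trans ?_ (hD u)
        gcongr <;> exact Finset.subset_univ S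

/-! ## Ancestor orders on a vertex set -/

/-- `r` is the ancestor order of a rooted forest of height at most `h` on the vertex set `s`
whose closure contains the subgraph of `G` induced by `s`. -/
structure IsClosureOrder {W : Type*} (G : SimpleGraph W) (s : Set W) (h : ℕ)
    (r : W → W → Prop) : Prop where
  refl : ∀ v ∈ s, r v v
  antisymm : ∀ u v, r u v → r v u → u = v
  trans : ∀ u v w, r u v → r v w → r u w
  chain : ∀ u v w, r u w → r v w → r u v ∨ r v u
  mem_left : ∀ u v, r u v → u ∈ s
  adj : ∀ u ∈ s, ∀ v ∈ s, G.Adj u v → r u v ∨ r v u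
  height : ∀ v, {u | r u v}.ncard ≤ h

theorem exists_isClosureOrder {W : Type*} {G : SimpleGraph W} {s : Set W} {h : ℕ}
    (hG : TreeDepthLE (G.induce s) h) : ∃ r, IsClosureOrder G s h r := by
  obtain ⟨r, ⟨hrefl, hanti, htrans, hchain⟩, hadj, hheight⟩ := hG
  refine ⟨fun u v => ∃ (hu : u ∈ s) (hv : v ∈ s), r ⟨u, hu⟩ ⟨v, hv⟩, ?_, ?_, ?_, ?_, ?_, ?_, ?_⟩
  · exact fun v hv => ⟨hv, hv, hrefl _⟩
  · rintro u v ⟨hu, hv, huv⟩ ⟨_, _, hvu⟩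
    exact congrArg Subtype.val (hanti _ _ huv hvu)
  · rintro u v w ⟨hu, hv, huv⟩ ⟨_, hw, hvw⟩
    exact ⟨hu, hw, htrans _ _ _ huv hvw⟩
  · rintro u v w ⟨hu, hw, huw⟩ ⟨hv, _, hvw⟩
    exact (hchain _ _ _ huw hvw).imp (fun h => ⟨hu, hv, h⟩) fun h => ⟨hv, hu, h⟩
  · exact fun u v ⟨hu, _⟩ => hu
  · exact fun u hu v hv huv =>
      (hadj ⟨u, hu⟩ ⟨v, hv⟩ huv).imp (fun h => ⟨hu, hv, h⟩) fun h => ⟨hv, hu, h⟩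
  · intro v
    by_cases hv : v ∈ s
    · have : {u | ∃ (hu : u ∈ s) (hv : v ∈ s), r ⟨u, hu⟩ ⟨v, hv⟩}
          = Subtype.val '' {u : s | r u ⟨v, hv⟩} := by
        ext u
        simp [hv]
      rw [this, Set.ncard_image_of_injective _ Subtype.val_injective]
      exact hheight _
    · simp [hv]

namespace IsClosureOrder

variable {W : Type*} {G : SimpleGraph W} {s : Set W} {h : ℕ} {r : W → W → Prop}

/-- The vertices of a path have a common ancestor among them. -/
theorem exists_top (hr : IsClosureOrder G s h r) (x : ℕ → W) (m : ℕ)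
    (hs : ∀ i ≤ m, x i ∈ s) (hx : ∀ i < m, G.Adj (x i) (x (i + 1))) :
    ∃ i ≤ m, ∀ j ≤ m, r (x i) (x j) := by
  induction m with
  | zero => exact ⟨0, le_rfl, fun j hj => by
      obtain rfl := Nat.le_zero.mp hj
      exact hr.refl _ (hs _ le_rfl)⟩
  | succ m ih =>
    obtain ⟨i, hi, htop⟩ := ih (fun i hi => hs i (by omega)) fun i hi => hx i (by omega)
    have hlast := hr.refl _ (hs (m + 1) le_rfl)
    have hcmp : r (x i) (x (m + 1)) ∨ r (x (m + 1)) (x i) := by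
      rcases hr.adj _ (hs m (by omega)) _ (hs (m + 1) le_rfl) (hx m (by omega)) with h1 | h1
      · exact Or.inl (hr.trans _ _ _ (htop m le_rfl) h1)
      · exact hr.chain _ _ _ (htop m le_rfl) h1
    rcases hcmp with h1 | h1
    · refine ⟨i, by omega, fun j hj => ?_⟩
      rcases Nat.le_succ_iff.mp hj with hj | rfl
      · exact htop j hj
      · exact h1
    · refine ⟨m + 1, le_rfl, fun j hj => ?_⟩
      rcases Nat.le_succ_iff.mp hj with hj | rfl
      · exact hr.trans _ _ _ h1 (htop j hj)
      · exact hlast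

variable [Finite W]

/-- A proper descendant has strictly more ancestors. -/
theorem ncard_lt (hr : IsClosureOrder G s h r) {u v : W} (huv : r u v) (hne : u ≠ v)
    (hv : v ∈ s) : {w | r w u}.ncard < {w | r w v}.ncard :=
  Set.ncard_lt_ncard ⟨fun _ hw => hr.trans _ _ _ hw huv,
    fun hsub => hne (hr.antisymm _ _ huv (hsub (hr.refl v hv)))⟩ (Set.toFinite _)

/-- At most `b` ancestors of a given vertex have height at most `b`. -/
theorem ncard_ancestors_le (hr : IsClosureOrder G s h r) (v : W) (b : ℕ) :
    {w | r w v ∧ {z | r z w}.ncard ≤ b}.ncard ≤ b := by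
  have hinj : Set.InjOn (fun w => {z | r z w}.ncard) {w | r w v ∧ {z | r z w}.ncard ≤ b} := by
    intro w hw w' hw' heq
    by_contra hne
    rcases hr.chain _ _ _ hw.1 hw'.1 with h1 | h1
    · exact (hr.ncard_lt h1 hne (hr.mem_left _ _ hw'.1)).ne heq
    · exact (hr.ncard_lt h1 (Ne.symm hne) (hr.mem_left _ _ hw.1)).ne' heq
  rw [← hinj.ncard_image]
  refine (Set.ncard_le_ncard (t := Set.Icc 1 b) ?_ (Set.toFinite _)).trans ?_
  · rintro _ ⟨w, hw, rfl⟩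
    exact ⟨(Set.ncard_pos (Set.toFinite _)).mpr ⟨w, hr.refl w (hr.mem_left _ _ hw.1)⟩, hw.2⟩
  · simp [Set.ncard_eq_toFinset_card']

/-- An edge among the proper descendants of `w` forces the height of `w` to be small. -/
theorem ncard_add_two_le (hr : IsClosureOrder G s h r) {w y z : W} (hy : y ∈ s) (hz : z ∈ s)
    (hwy : r w y) (hwz : r w z) (hney : y ≠ w) (hnez : z ≠ w) (hyz : G.Adj y z) :
    {u | r u w}.ncard + 2 ≤ h := by
  have h1 := hr.ncard_lt hwy hney.symm hy
  have h2 := hr.ncard_lt hwz hnez.symm hz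
  rcases hr.adj y hy z hz hyz with hc | hc
  · have h3 := hr.ncard_lt hc hyz.ne hz
    have h4 := hr.height z
    omega
  · have h3 := hr.ncard_lt hc hyz.ne' hy
    have h4 := hr.height y
    omega

end IsClosureOrder

/-- The bound on the height of the top vertex of a path with monochromatic ends using `j + 1`
colors; it also bounds the number of possible such top vertices above a given vertex. -/
def topBound (j : ℕ) : ℕ := if j = 1 then 1 else j - 1

/-- The top vertex of a path whose ends have the same color and which uses `j + 1` colors. -/
theorem IsClosureOrder.exists_low_top {W : Type*} [Finite W] {G : SimpleGraph W} {s : Set W}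
    {j : ℕ} {r : W → W → Prop} (hr : IsClosureOrder G s (j + 1) r) (x : ℕ → W) {m : ℕ}
    (hs : ∀ i ≤ m, x i ∈ s) (hx : ∀ i < m, G.Adj (x i) (x (i + 1)))
    (hinj : Set.InjOn x (Set.Iic m)) (hj : 1 ≤ j) (hjm : j + 1 ≤ m) :
    ∃ i ≤ m, r (x i) (x 0) ∧ r (x i) (x m) ∧ {u | r u (x i)}.ncard ≤ topBound j ∧
      (j = 1 → x i ≠ x 0 ∧ x i ≠ x m) := by
  obtain ⟨i, hi, htop⟩ := hr.exists_top x m hs hx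
  have hne : ∀ l ≤ m, l ≠ i → x l ≠ x i := fun l hl hli h => hli (hinj hl hi h)
  have hpos : 1 ≤ {u | r u (x i)}.ncard :=
    (Set.ncard_pos (Set.toFinite _)).mpr ⟨x i, htop i hi⟩
  have hlow : ∀ l < m, l ≠ i → l + 1 ≠ i → {u | r u (x i)}.ncard + 2 ≤ j + 1 :=
    fun l hl h1 h2 => hr.ncard_add_two_le (hs l hl.le) (hs _ hl) (htop l hl.le) (htop _ hl)
      (hne l hl.le h1) (hne _ hl h2) (hx l hl)
  refine ⟨i, hi, htop 0 (by omega), htop m le_rfl, ?_⟩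
  by_cases hm : 3 ≤ m
  · have : {u | r u (x i)}.ncard + 2 ≤ j + 1 := by
      by_cases h0 : i = 0
      · exact hlow 1 (by omega) (by omega) (by omega)
      · by_cases h1 : i = 1
        · exact hlow 2 (by omega) (by omega) (by omega)
        · exact hlow 0 (by omega) (by omega) (by omega)
    have hj1 : j ≠ 1 := by omega
    refine ⟨?_, fun h => absurd h hj1⟩
    rw [topBound, if_neg hj1]
    omega
  · obtain rfl : m = 2 := by omega
    obtain rfl : j = 1 := by omega
    have hi0 : i ≠ 0 := fun h => by
      have := hlow 1 (by omega) (by omega) (by omega)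
      omega
    have hi2 : i ≠ 2 := fun h => by
      have := hlow 0 (by omega) (by omega) (by omega)
      omega
    refine ⟨?_, fun _ => ⟨(hne 0 (by omega) (Ne.symm hi0)).symm,
      (hne 2 le_rfl (Ne.symm hi2)).symm⟩⟩
    have h1 := hr.ncard_lt (htop 0 (by omega)) (hne 0 (by omega) (Ne.symm hi0)).symm
      (hs 0 (by omega))
    have h2 := hr.height (x 0)
    rw [topBound, if_pos rfl]
    omega

/-! ## Paths of a subdivision -/

/-- The path of the subdivision that replaces the edge `e`. -/
def subdivPath {n : ℕ} (H : SimpleGraph (Fin n)) (t : Edges H → ℕ) (e : Edges H) (i : ℕ) :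
    Fin n ⊕ Σ e : Edges H, Fin (t e) :=
  if i = 0 then Sum.inl e.1.1
  else if h : i - 1 < t e then Sum.inr ⟨e, ⟨i - 1, h⟩⟩ else Sum.inl e.1.2

section SubdivPath

variable {n : ℕ} {H : SimpleGraph (Fin n)} {t : Edges H → ℕ} {e : Edges H}

@[simp]
theorem subdivPath_zero : subdivPath H t e 0 = Sum.inl e.1.1 := rfl

theorem subdivPath_succ {i : ℕ} (h : i < t e) :
    subdivPath H t e (i + 1) = Sum.inr ⟨e, ⟨i, h⟩⟩ := by
  simp [subdivPath, h]

@[simp]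
theorem subdivPath_last : subdivPath H t e (t e + 1) = Sum.inl e.1.2 := by
  simp [subdivPath]

theorem subdivPath_cases {i : ℕ} (hi : i ≤ t e + 1) :
    i = 0 ∨ i = t e + 1 ∨ ∃ l, l < t e ∧ i = l + 1 := by
  rcases i with _ | l
  · exact Or.inl rfl
  · by_cases h : l < t e
    · exact Or.inr (Or.inr ⟨l, h, rfl⟩)
    · exact Or.inr (Or.inl (by omega))

theorem subdivPath_injOn : Set.InjOn (subdivPath H t e) (Set.Iic (t e + 1)) := by
  have hne : e.1.1 ≠ e.1.2 := e.2.1.ne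
  intro i hi l hl hil
  rcases subdivPath_cases hi with rfl | rfl | ⟨i, hi', rfl⟩ <;>
  rcases subdivPath_cases hl with rfl | rfl | ⟨l, hl', rfl⟩ <;>
  simp_all [subdivPath_succ]

theorem subdivPath_adj {i : ℕ} (hi : i < t e + 1) :
    (Subdiv H t).Adj (subdivPath H t e i) (subdivPath H t e (i + 1)) := by
  have hne : subdivPath H t e i ≠ subdivPath H t e (i + 1) := fun h => by
    have := subdivPath_injOn (show i ∈ Set.Iic (t e + 1) from hi.le)
      (show i + 1 ∈ Set.Iic (t e + 1) from hi) h
    omega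
  refine (SimpleGraph.fromRel_adj _ _ _).mpr ⟨hne, ?_⟩
  rcases i with _ | i
  · by_cases h0 : 0 < t e
    · rw [subdivPath_zero, subdivPath_succ h0]
      exact Or.inl (Or.inl ⟨rfl, rfl⟩)
    · have h0 : t e = 0 := by omega
      have hl : subdivPath H t e (0 + 1) = Sum.inl e.1.2 := by
        rw [← subdivPath_last (t := t), h0]
      rw [subdivPath_zero, hl]
      exact Or.inl ⟨e.2, h0⟩
  · have hi' : i < t e := by omega
    rw [subdivPath_succ hi']
    by_cases h : i + 1 < t e
    · rw [subdivPath_succ h]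
      exact Or.inl ⟨rfl, rfl⟩
    · have h1 : i + 1 = t e := by omega
      rw [h1, subdivPath_last]
      exact Or.inr (Or.inr ⟨rfl, h1⟩)

end SubdivPath

/-! ## Colorings of low tree-depth -/

theorem chiP_spec {N : ℕ} (G : SimpleGraph (Fin N)) (p : ℕ) :
    ∃ c : Fin N → Fin (chiP G p), ∀ I : Finset (Fin (chiP G p)), I.card ≤ p →
      TreeDepthLE (G.induce {v | c v ∈ I}) I.card := by
  refine Nat.sInf_mem (s := {k | ∃ c : Fin N → Fin k, ∀ I : Finset (Fin k), I.card ≤ p →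
    TreeDepthLE (G.induce {v | c v ∈ I}) I.card}) ⟨N, id, fun I _ => ⟨fun u v => u ≤ v,
      ⟨fun _ => le_rfl, fun _ _ => le_antisymm, fun _ _ _ => le_trans,
        fun u v _ _ _ => le_total u v⟩, fun u v _ => le_total u v, fun v => ?_⟩⟩
  refine (Set.ncard_le_card _).trans (le_of_eq ?_)
  simp

/-- A color class of tree-depth at most one contains no edge. -/
theorem ne_of_adj_of_treeDepthLE_one {W α : Type*} [Finite W] {G : SimpleGraph W} {c : W → α}
    {a : α} (h : TreeDepthLE (G.induce {v | c v ∈ ({a} : Finset α)}) 1) {u v : W}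
    (huv : G.Adj u v) (hu : c u = a) : c v ≠ a := by
  intro hv
  obtain ⟨r, hr⟩ := exists_isClosureOrder h
  have hu' : u ∈ {v | c v ∈ ({a} : Finset α)} := by simpa using hu
  have hv' : v ∈ {v | c v ∈ ({a} : Finset α)} := by simpa using hv
  have hpos : ∀ w ∈ {v | c v ∈ ({a} : Finset α)}, 1 ≤ {z | r z w}.ncard := fun w hw =>
    (Set.ncard_pos (Set.toFinite _)).mpr ⟨w, hr.refl w hw⟩
  rcases hr.adj u hu' v hv' huv with h1 | h1
  · have := hr.ncard_lt h1 huv.ne hv'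
    have := hr.height v
    have := hpos u hu'
    omega
  · have := hr.ncard_lt h1 huv.ne' hu'
    have := hr.height u
    have := hpos v hv'
    omega

/-! ## Counting -/

theorem two_mul_le_factorial_succ (r : ℕ) : 2 * r ≤ (r + 1).factorial := by
  rcases r with _ | r
  · simp
  · rw [Nat.factorial_succ]
    have := Nat.self_le_factorial (r + 1)
    nlinarith

theorem sum_choose_mul_topBound_le (M r : ℕ) (hr : 1 ≤ r) :
    M + 2 * ∑ j ∈ Finset.Icc 2 r, M.choose j * topBound j + 1 ≤ (M + 1) ^ r := by
  induction r, hr using Nat.le_induction with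
  | base => simp
  | succ r hr ih =>
    rw [Finset.sum_Icc_succ_top (by omega)]
    have h1 : topBound (r + 1) = r := by simp [topBound, show r ≠ 0 by omega]
    have h2 : 2 * (M.choose (r + 1) * r) ≤ M ^ (r + 1) := by
      calc 2 * (M.choose (r + 1) * r) = (2 * r) * M.choose (r + 1) := by ring
        _ ≤ (r + 1).factorial * M.choose (r + 1) :=
            Nat.mul_le_mul_right _ (two_mul_le_factorial_succ r)
        _ = M.descFactorial (r + 1) := (Nat.descFactorial_eq_factorial_mul_choose _ _).symm
        _ ≤ M ^ (r + 1) := Nat.descFactorial_le_pow _ _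
    have h3 : M ^ (r + 1) ≤ (M + 1) ^ r * M := by
      rw [pow_succ]
      exact Nat.mul_le_mul_right _ (Nat.pow_le_pow_left (by omega) _)
    rw [h1, pow_succ]
    linarith

/-- A set of vertices `v` injectively labelled by low ancestors of `x` in orders indexed by
`(j + 1)`-sets of colors containing `a` has bounded size. -/
theorem card_le_choose_mul_topBound {V W : Type*} [Finite W] {G : SimpleGraph W} {k j : ℕ}
    {s : Finset (Fin k) → Set W} {ord : Finset (Fin k) → W → W → Prop}
    (hord : ∀ I, I.card = j + 1 → IsClosureOrder G (s I) (j + 1) (ord I))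
    (a : Fin k) (x : W) (S : Finset V) (I : V → Finset (Fin k)) (w : V → W)
    (hI : ∀ v ∈ S, a ∈ I v ∧ (I v).card = j + 1)
    (hw : ∀ v ∈ S, ord (I v) (w v) x ∧ {z | ord (I v) z (w v)}.ncard ≤ topBound j)
    (hinj : Set.InjOn w S) : S.card ≤ (k - 1).choose j * topBound j := by
  classical
  have hmaps : ∀ v ∈ S, (I v).erase a ∈ Finset.powersetCard j (Finset.univ.erase a) := by
    intro v hv
    rw [Finset.mem_powersetCard, Finset.card_erase_of_mem (hI v hv).1, (hI v hv).2]
    exact ⟨Finset.erase_subset_erase _ (Finset.subset_univ _), by omega⟩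
  refine (Finset.card_le_mul_card_image_of_maps_to hmaps (topBound j) fun J _ => ?_).trans
    (le_of_eq ?_)
  · rcases (S.filter fun v => (I v).erase a = J).eq_empty_or_nonempty with h0 | ⟨v₀, hv₀⟩
    · simp [h0]
    have hIJ : ∀ v ∈ S.filter (fun v => (I v).erase a = J), I v = insert a J := by
      intro v hv
      rw [Finset.mem_filter] at hv
      rw [← hv.2, Finset.insert_erase (hI v hv.1).1]
    have hJ : (insert a J).card = j + 1 := by
      rw [← hIJ v₀ hv₀]
      exact (hI v₀ (Finset.mem_filter.mp hv₀).1).2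
    rw [← Set.ncard_coe_finset, ← (hinj.mono (Finset.coe_subset.mpr (Finset.filter_subset _ S))).ncard_image]
    refine (Set.ncard_le_ncard ?_ (Set.toFinite _)).trans
      ((hord _ hJ).ncard_ancestors_le x (topBound j))
    rintro _ ⟨v, hv, rfl⟩
    have := hw v (Finset.mem_filter.mp hv).1
    rwa [hIJ v hv] at this
  · rw [Finset.card_powersetCard, Finset.card_erase_of_mem (Finset.mem_univ a),
      Finset.card_univ, Fintype.card_fin, mul_comm]

/-- The path replacing an edge of `H` with ends of the same color uses at least two and at most
`p` colors, and has a low top vertex. -/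
theorem exists_edge_top {W : Type*} [Finite W] {G : SimpleGraph W} {k p n : ℕ} {c : W → Fin k}
    (hc : ∀ I : Finset (Fin k), I.card ≤ p → TreeDepthLE (G.induce {v | c v ∈ I}) I.card)
    {ord : Finset (Fin k) → W → W → Prop}
    (hord : ∀ I : Finset (Fin k), I.card ≤ p →
      IsClosureOrder G {v | c v ∈ I} I.card (ord I))
    {H : SimpleGraph (Fin n)} {t : Edges H → ℕ} (f : Subdiv H t →g G)
    (hf : Function.Injective f) (e : Edges H) (ht : t e + 1 ≤ p)
    (he : c (f (Sum.inl e.1.1)) = c (f (Sum.inl e.1.2))) :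
    ∃ (I : Finset (Fin k)) (j : ℕ) (w : Fin n ⊕ Σ e : Edges H, Fin (t e)),
      c (f (Sum.inl e.1.1)) ∈ I ∧ I.card = j + 1 ∧ 1 ≤ j ∧ j + 1 ≤ p ∧
      (w = Sum.inl e.1.1 ∨ w = Sum.inl e.1.2 ∨ ∃ i, w = Sum.inr ⟨e, i⟩) ∧
      ord I (f w) (f (Sum.inl e.1.1)) ∧ ord I (f w) (f (Sum.inl e.1.2)) ∧
      {z | ord I z (f w)}.ncard ≤ topBound j ∧
      (j = 1 → w ≠ Sum.inl e.1.1 ∧ w ≠ Sum.inl e.1.2) := by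
  classical
  set x : ℕ → W := fun i => f (subdivPath H t e i) with hxdef
  have hx0 : x 0 = f (Sum.inl e.1.1) := by simp [hxdef]
  have hxm : x (t e + 1) = f (Sum.inl e.1.2) := by simp [hxdef]
  have hadj : ∀ i < t e + 1, G.Adj (x i) (x (i + 1)) := fun i hi => f.map_adj (subdivPath_adj hi)
  have hinj : Set.InjOn x (Set.Iic (t e + 1)) := fun i hi l hl h =>
    subdivPath_injOn hi hl (hf h)
  set I : Finset (Fin k) := (Finset.range (t e + 1)).image fun i => c (x i) with hI
  have hmem : ∀ i ≤ t e + 1, c (x i) ∈ I := by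
    intro i hi
    rcases hi.lt_or_eq with hi | rfl
    · exact Finset.mem_image.mpr ⟨i, Finset.mem_range.mpr hi, rfl⟩
    · exact Finset.mem_image.mpr ⟨0, by simp, by rw [hx0, hxm, he]⟩
  have hIle : I.card ≤ t e + 1 := Finset.card_image_le.trans (by simp)
  have hne : c (x 1) ≠ c (x 0) := by
    refine ne_of_adj_of_treeDepthLE_one ?_ (hadj 0 (by omega)) rfl
    simpa using hc {c (x 0)} (by simp; omega)
  have h2 : 1 < I.card := Finset.one_lt_card.mpr
    ⟨c (x 1), hmem 1 (by omega), c (x 0), hmem 0 (by omega), hne⟩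
  obtain ⟨j, hj⟩ : ∃ j, I.card = j + 1 := ⟨I.card - 1, by omega⟩
  have hr := hord I (hIle.trans ht)
  rw [hj] at hr
  obtain ⟨i, hi, h0, hm, hlow, hends⟩ := hr.exists_low_top x hmem hadj hinj (by omega) (by omega)
  refine ⟨I, j, subdivPath H t e i, hx0 ▸ hmem 0 (by omega), hj, by omega, by omega, ?_,
    hx0 ▸ h0, hxm ▸ hm, hlow, fun h => ?_⟩
  · rcases subdivPath_cases hi with rfl | rfl | ⟨l, hl, rfl⟩
    · simp
    · simp
    · exact Or.inr (Or.inr ⟨_, subdivPath_succ hl⟩)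
  · exact ⟨fun h' => (hends h).1 ((congrArg f h').trans hx0.symm),
      fun h' => (hends h).2 ((congrArg f h').trans hxm.symm)⟩

/-- The subgraph of the edges of `H` whose ends receive the same color. -/
def monochromaticSubgraph {V α : Type*} (H : SimpleGraph V) (d : V → α) : SimpleGraph V where
  Adj u v := H.Adj u v ∧ d u = d v
  symm := ⟨fun _ _ h => ⟨h.1.symm, h.2.symm⟩⟩
  loopless := ⟨fun _ h => h.1.ne rfl⟩

theorem colorable_mul_of_monochromaticSubgraph {V : Type*} {H : SimpleGraph V} {k m : ℕ}
    (d : V → Fin k) (h : (monochromaticSubgraph H d).Colorable m) : H.Colorable (k * m) := by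
  obtain ⟨b⟩ := h
  have hcol : H.Coloring (Fin k × Fin m) :=
    SimpleGraph.Coloring.mk (fun v => (d v, b v)) fun {u v} huv heq =>
      b.valid (v := u) (w := v) ⟨huv, congrArg Prod.fst heq⟩ (congrArg Prod.snd heq)
  simpa using hcol.colorable

/-- `e` is the edge with ends `u` and `v`. -/
def Edges.Joins {n : ℕ} {H : SimpleGraph (Fin n)} (e : Edges H) (u v : Fin n) : Prop :=
  (e.1.1 = u ∧ e.1.2 = v) ∨ (e.1.1 = v ∧ e.1.2 = u)

theorem Edges.exists_joins {n : ℕ} {H : SimpleGraph (Fin n)} {u v : Fin n} (h : H.Adj u v) :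
    ∃ e : Edges H, e.Joins u v := by
  rcases lt_or_gt_of_ne h.ne with hlt | hlt
  · exact ⟨⟨(u, v), hlt, h⟩, Or.inl ⟨rfl, rfl⟩⟩
  · exact ⟨⟨(v, u), hlt, h.symm⟩, Or.inr ⟨rfl, rfl⟩⟩

/-- The edges of a shallow topological minor with ends of the same color form a graph that is
colorable with `k ^ (p - 1)` colors. -/
theorem monochromaticSubgraph_colorable {W : Type*} [Finite W] {G : SimpleGraph W}
    {k p n : ℕ} (hk : 1 ≤ k) {c : W → Fin k}
    (hc : ∀ I : Finset (Fin k), I.card ≤ p → TreeDepthLE (G.induce {v | c v ∈ I}) I.card)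
    {H : SimpleGraph (Fin n)} {t : Edges H → ℕ} (ht : ∀ e, t e + 1 ≤ p) (f : Subdiv H t →g G)
    (hf : Function.Injective f) :
    (monochromaticSubgraph H fun v => c (f (Sum.inl v))).Colorable (k ^ (p - 1)) := by
  classical
  have hex : ∀ I : Finset (Fin k), ∃ r, I.card ≤ p →
      IsClosureOrder G {v | c v ∈ I} I.card r := fun I => by
    by_cases h : I.card ≤ p
    · exact (exists_isClosureOrder (hc I h)).imp fun _ h _ => h
    · exact ⟨fun _ _ => False, fun h' => absurd h' h⟩
  choose ord hord using hex
  choose I j w hI hIj hj hjp hw hw1 hw2 hlow hends using fun (e : Edges H) he =>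
    exists_edge_top hc hord f hf e (ht e) he
  set d : Fin n → Fin k := fun v => c (f (Sum.inl v)) with hd
  let out (i : ℕ) (u v : Fin n) : Prop := ∃ (e : Edges H) (he : d e.1.1 = d e.1.2),
    e.Joins u v ∧ j e he = i ∧ w e he ≠ Sum.inl u
  have hout : ∀ i u, (Finset.univ.filter (out i u)).card ≤ (k - 1).choose i * topBound i := by
    intro i u
    by_cases hip : i + 1 ≤ p
    · have hch : ∀ v, ∃ (J : Finset (Fin k)) (y : Fin n ⊕ Σ e : Edges H, Fin (t e)),
          out i u v → ∃ (e : Edges H) (he : d e.1.1 = d e.1.2),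
            e.Joins u v ∧ j e he = i ∧ y ≠ Sum.inl u ∧ J = I e he ∧ y = w e he := by
        intro v
        by_cases h : out i u v
        · obtain ⟨e, he, h1, h2, h3⟩ := h
          exact ⟨I e he, w e he, fun _ => ⟨e, he, h1, h2, h3, rfl, rfl⟩⟩
        · exact ⟨∅, Sum.inl u, fun h' => absurd h' h⟩
      choose J y hJy using hch
      refine card_le_choose_mul_topBound (s := fun I => {v | c v ∈ I}) (ord := ord)
        (fun I' hI' => hI' ▸ hord I' (by omega)) (d u) (f (Sum.inl u)) _ J (fun v => f (y v))
        ?_ ?_ ?_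
      · intro v hv
        obtain ⟨e, he, hjoin, rfl, -, hJ, -⟩ := hJy v (Finset.mem_filter.mp hv).2
        rw [hJ]
        refine ⟨?_, hIj e he⟩
        rcases hjoin with ⟨rfl, rfl⟩ | ⟨rfl, rfl⟩
        · exact hI e he
        · exact he ▸ hI e he
      · intro v hv
        obtain ⟨e, he, hjoin, rfl, -, hJ, hy⟩ := hJy v (Finset.mem_filter.mp hv).2
        rw [hJ, hy]
        refine ⟨?_, hlow e he⟩
        rcases hjoin with ⟨rfl, rfl⟩ | ⟨rfl, rfl⟩
        · exact hw1 e he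
        · exact hw2 e he
      · have hkey : ∀ v ∈ Finset.univ.filter (out i u), ∃ e : Edges H, e.Joins u v ∧
            (y v = Sum.inl v ∨ ∃ l, y v = Sum.inr ⟨e, l⟩) := by
          intro v hv
          obtain ⟨e, he, hjoin, -, hyu, -, hy⟩ := hJy v (Finset.mem_filter.mp hv).2
          refine ⟨e, hjoin, ?_⟩
          have := hw e he
          rw [← hy] at this
          rcases hjoin with ⟨rfl, rfl⟩ | ⟨rfl, rfl⟩ <;> tauto
        intro v hv v' hv' heq
        have heq := hf heq
        obtain ⟨e, hjoin, hy⟩ := hkey v hv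
        obtain ⟨e', hjoin', hy'⟩ := hkey v' hv'
        rcases hy with hy | ⟨l, hy⟩ <;> rcases hy' with hy' | ⟨l', hy'⟩ <;>
          rw [hy, hy'] at heq
        · exact Sum.inl_injective heq
        · cases heq
        · cases heq
        · obtain rfl : e = e' := congrArg Sigma.fst (Sum.inr_injective heq)
          have := e.2.1.ne
          rcases hjoin with ⟨h1, h2⟩ | ⟨h1, h2⟩ <;> rcases hjoin' with ⟨h3, h4⟩ | ⟨h3, h4⟩
          · rw [← h2, h4]
          · exact absurd (h1.trans h4.symm) this
          · exact absurd (h3.trans h2.symm) this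
          · rw [← h1, h3]
    · rw [Finset.filter_false_of_mem]
      · simp
      · rintro v - ⟨e, he, -, rfl, -⟩
        exact hip (hjp e he)
  rcases Nat.lt_or_ge p 2 with hp | hp
  · have hbot : ∀ u v, ¬ (monochromaticSubgraph H d).Adj u v := by
      rintro u v ⟨huv, hduv⟩
      obtain ⟨e, hjoin⟩ := Edges.exists_joins huv
      have he : d e.1.1 = d e.1.2 := by
        rcases hjoin with ⟨rfl, rfl⟩ | ⟨rfl, rfl⟩
        exacts [hduv, hduv.symm]
      have := hj e he
      have := hjp e he
      omega
    have hcol : (monochromaticSubgraph H d).Colorable 1 :=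
      ⟨SimpleGraph.Coloring.mk (fun _ => 0) fun {u v} h => absurd h (hbot u v)⟩
    exact hcol.mono (Nat.one_le_pow _ _ hk)
  · have hcol := colorable_of_outdegree (monochromaticSubgraph H d) (out 1)
      (fun u v => ∃ i ∈ Finset.Icc 2 (p - 1), out i u v)
      ((k - 1) + 2 * ∑ i ∈ Finset.Icc 2 (p - 1), (k - 1).choose i * topBound i) ?_ ?_
    · refine hcol.mono ?_
      have := sum_choose_mul_topBound_le (k - 1) (p - 1) (by omega)
      rwa [Nat.sub_add_cancel hk] at this
    · rintro u v ⟨huv, hduv⟩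
      obtain ⟨e, hjoin⟩ := Edges.exists_joins huv
      have he : d e.1.1 = d e.1.2 := by
        rcases hjoin with ⟨rfl, rfl⟩ | ⟨rfl, rfl⟩
        exacts [hduv, hduv.symm]
      have hjoin' : e.Joins v u := hjoin.symm
      have h1 := hj e he
      have h2 := hjp e he
      by_cases hj1 : j e he = 1
      · refine Or.inl ⟨e, he, hjoin, hj1, ?_⟩
        rcases hjoin with ⟨rfl, rfl⟩ | ⟨rfl, rfl⟩
        exacts [(hends e he hj1).1, (hends e he hj1).2]
      · have hmem : j e he ∈ Finset.Icc 2 (p - 1) := Finset.mem_Icc.mpr (by omega)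
        by_cases hu : w e he = Sum.inl u
        · refine Or.inr (Or.inr ⟨_, hmem, e, he, hjoin', rfl, fun hv => huv.ne ?_⟩)
          exact Sum.inl_injective (hu.symm.trans hv)
        · exact Or.inr (Or.inl ⟨_, hmem, e, he, hjoin, rfl, hu⟩)
    · intro u
      refine Nat.add_le_add ?_ (Nat.mul_le_mul_left 2 ?_)
      · simpa [topBound] using hout 1 u
      · refine (Finset.card_le_card (t := (Finset.Icc 2 (p - 1)).biUnion fun i =>
          Finset.univ.filter (out i u)) fun v hv => ?_).trans (Finset.card_biUnion_le.trans
            (Finset.sum_le_sum fun i _ => hout i u))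
        simpa using hv

/-- For every graph `G`, every positive integer `p` and every
`H ∈ TM_{p-1}(G)`, one has `χ(H) ≤ χ_p(G)^p` (i.e. `χ_p(G) ≥ χ(TM_{p-1}(G))^{1/p}`). -/
theorem chi_of_memTM_le_chiP_pow (N : ℕ) (G : SimpleGraph (Fin N)) (p : ℕ) (hp : 1 ≤ p)
    (n : ℕ) (H : SimpleGraph (Fin n)) (hH : MemTM (p - 1) G H) :
    chi H ≤ chiP G p ^ p := by
  obtain ⟨t, ht, f, hf⟩ := hH
  obtain ⟨c, hc⟩ := chiP_spec G p
  refine Nat.sInf_le (show H.Colorable _ from ?_)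
  rcases Nat.eq_zero_or_pos (chiP G p) with h0 | hk
  · have : IsEmpty (Fin n) := ⟨fun v => (h0 ▸ c (f (Sum.inl v))).elim0⟩
    exact SimpleGraph.Colorable.of_isEmpty _
  · have h := colorable_mul_of_monochromaticSubgraph _
      (monochromaticSubgraph_colorable hk hc (fun e => by have := ht e; omega) f hf)
    rwa [← pow_succ', Nat.sub_add_cancel hp] at h
end

section
/- Let 𝒞 be a hereditary class of graphs and let p be a positive integer. If there is a function f such that χ_{p+1}(G) ≤ f(ω(TM_p(G))) holds for all G ∈ 𝒞, then sup{χ(H) : H ∈ ITM_p^e(𝒞)} < ∞. -/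
open SimpleGraph

/-! ## Tree-depth and minors -/

/-- Tree-depth does not increase when passing to a subgraph. -/
theorem TreeDepthLE.of_injective_hom {V W : Type*} [Finite W] {G : SimpleGraph V}
    {G' : SimpleGraph W} {h : ℕ} (hG' : TreeDepthLE G' h) (φ : G →g G')
    (hφ : Function.Injective φ) : TreeDepthLE G h := by
  obtain ⟨r, ⟨hrefl, hanti, htrans, hchain⟩, hadj, hcard⟩ := hG'
  refine ⟨fun u v => r (φ u) (φ v), ⟨fun v => hrefl _, fun u v h₁ h₂ => hφ (hanti _ _ h₁ h₂),
    fun u v w => htrans _ _ _, fun u v w => hchain _ _ _⟩,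
    fun u v huv => hadj _ _ (φ.map_adj huv), fun v => ?_⟩
  refine le_trans ?_ (hcard (φ v))
  exact Set.ncard_le_ncard_of_injOn φ (fun u hu => hu) hφ.injOn (Set.toFinite _)

/-- A graph having a model as a minor of a graph of tree-depth at most `h` has a proper
`(h + 1)`-coloring. Connectedness of the branch sets is expressed by a propagation
principle. -/
theorem TreeDepthLE.colorable_of_minor {V U : Type*} [Finite V] {G : SimpleGraph V} {s : Set V}
    {h : ℕ} (hG : TreeDepthLE (G.induce s) h) (H : SimpleGraph U) (B : U → Set V)
    (hBs : ∀ u, B u ⊆ s)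
    (hdisj : ∀ u v x, x ∈ B u → x ∈ B v → u = v)
    (hconn : ∀ u, ∀ P : V → Prop,
      (∀ a ∈ B u, ∀ b ∈ B u, G.Adj a b → P a → P b) →
      ∀ x ∈ B u, P x → ∀ y ∈ B u, P y)
    (hedge : ∀ u v, H.Adj u v → ∃ a ∈ B u, ∃ b ∈ B v, G.Adj a b) :
    H.Colorable (h + 1) := by
  classical
  obtain ⟨r, ⟨hrefl, hanti, htrans, hchain⟩, hadj, hcard⟩ := hG
  have hmono : ∀ x y, r x y → {z | r z x}.ncard = {z | r z y}.ncard → x = y := by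
    intro x y hxy heq
    have hsub : {z | r z x} ⊆ {z | r z y} := fun z hz => htrans _ _ _ hz hxy
    have hset := Set.eq_of_subset_of_ncard_le hsub heq.ge (Set.toFinite _)
    have hy : y ∈ {z | r z x} := hset ▸ hrefl y
    exact hanti _ _ hxy hy
  have htop : ∀ u, (B u).Nonempty → ∃ x : s, x.1 ∈ B u ∧ ∀ y : s, y.1 ∈ B u → r x y := by
    intro u ⟨b, hb⟩
    obtain ⟨x, hx, hmin⟩ := Set.exists_min_image {x : s | x.1 ∈ B u}
      (fun x => {z | r z x}.ncard) (Set.toFinite _) ⟨⟨b, hBs u hb⟩, hb⟩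
    refine ⟨x, hx, fun y hy => ?_⟩
    have key := hconn u (fun z => ∀ hz : z ∈ s, r x ⟨z, hz⟩) (by
      intro a ha b hb hab hPa hbs
      rcases hadj ⟨a, hBs u ha⟩ ⟨b, hbs⟩ hab with h₁ | h₁
      · exact htrans _ _ _ (hPa _) h₁
      · rcases hchain _ _ _ (hPa (hBs u ha)) h₁ with h₂ | h₂
        · exact h₂
        · have hsub : {z | r z ⟨b, hbs⟩} ⊆ {z | r z x} := fun z hz => htrans _ _ _ hz h₂
          have := hmono _ _ h₂
            (le_antisymm (Set.ncard_le_ncard hsub (Set.toFinite _)) (hmin ⟨b, hbs⟩ hb))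
          rw [this]
          exact hrefl _) x.1 hx (fun _ => hrefl x) y.1 hy
    exact key y.2
  choose! top htopB htop using fun (u : {u // (B u).Nonempty}) => htop u.1 u.2
  refine ⟨Coloring.mk (fun u => if hu : (B u).Nonempty then
    ⟨{z | r z (top ⟨u, hu⟩)}.ncard, Nat.lt_succ_of_le (hcard _)⟩ else 0) ?_⟩
  intro u v huv heq
  obtain ⟨a, ha, b, hb, hab⟩ := hedge u v huv
  have hu : (B u).Nonempty := ⟨a, ha⟩
  have hv : (B v).Nonempty := ⟨b, hb⟩
  rw [dif_pos hu, dif_pos hv, Fin.mk.injEq] at heq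
  have hxa := htop ⟨u, hu⟩ ⟨a, hBs u ha⟩ ha
  have hyb := htop ⟨v, hv⟩ ⟨b, hBs v hb⟩ hb
  have hcomp : r (top ⟨u, hu⟩) (top ⟨v, hv⟩) ∨ r (top ⟨v, hv⟩) (top ⟨u, hu⟩) := by
    rcases hadj ⟨a, hBs u ha⟩ ⟨b, hBs v hb⟩ hab with h₁ | h₁
    · exact hchain _ _ _ (htrans _ _ _ hxa h₁) hyb
    · exact hchain _ _ _ hxa (htrans _ _ _ hyb h₁)
  have hxy : top ⟨u, hu⟩ = top ⟨v, hv⟩ := by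
    rcases hcomp with h₁ | h₁
    · exact hmono _ _ h₁ heq
    · exact (hmono _ _ h₁ heq.symm).symm
  refine huv.ne (hdisj u v (top ⟨u, hu⟩).1 (htopB ⟨u, hu⟩) ?_)
  rw [hxy]
  exact htopB ⟨v, hv⟩

/-- The infimum defining `chiP` is attained. -/
theorem exists_coloring_chiP {n : ℕ} (G : SimpleGraph (Fin n)) (p : ℕ) :
    ∃ c : Fin n → Fin (chiP G p), ∀ I : Finset (Fin (chiP G p)), I.card ≤ p →
      TreeDepthLE (G.induce {v | c v ∈ I}) I.card := by
  refine Nat.sInf_mem (s := {N | ∃ c : Fin n → Fin N, ∀ I : Finset (Fin N), I.card ≤ p →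
    TreeDepthLE (G.induce {v | c v ∈ I}) I.card}) ⟨n, id, fun I _ => ?_⟩
  refine ⟨fun u v => u.1 ≤ v.1, ⟨fun v => le_refl _, fun u v h₁ h₂ => Subtype.ext
    (le_antisymm h₁ h₂), fun u v w => le_trans, fun u v w _ _ => le_total _ _⟩,
    fun u v _ => le_total _ _, fun v => ?_⟩
  rw [← Set.ncard_coe_finset I]
  exact Set.ncard_le_ncard_of_injOn Subtype.val (fun u _ => u.2)
    Subtype.val_injective.injOn (Set.toFinite _)

/-! ## Structure of subdivisions -/

instance {n : ℕ} (H : SimpleGraph (Fin n)) : Finite (Edges H) :=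
  inferInstanceAs (Finite {p : Fin n × Fin n // p.1 < p.2 ∧ H.Adj p.1 p.2})

namespace Subdiv

variable {n : ℕ} {H : SimpleGraph (Fin n)} {t : Edges H → ℕ}

theorem adj_direct (e : Edges H) (he : t e = 0) :
    (Subdiv H t).Adj (Sum.inl e.1.1) (Sum.inl e.1.2) := by
  refine (SimpleGraph.fromRel_adj _ _ _).2 ⟨?_, Or.inl ⟨e.2, he⟩⟩
  exact fun h => e.2.1.ne (Sum.inl.inj h)

theorem adj_first (e : Edges H) (i : Fin (t e)) (hi : (i : ℕ) = 0) :
    (Subdiv H t).Adj (Sum.inl e.1.1) (Sum.inr ⟨e, i⟩) :=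
  (SimpleGraph.fromRel_adj _ _ _).2 ⟨Sum.inl_ne_inr, Or.inl (Or.inl ⟨rfl, hi⟩)⟩

theorem adj_last (e : Edges H) (i : Fin (t e)) (hi : (i : ℕ) + 1 = t e) :
    (Subdiv H t).Adj (Sum.inl e.1.2) (Sum.inr ⟨e, i⟩) :=
  (SimpleGraph.fromRel_adj _ _ _).2 ⟨Sum.inl_ne_inr, Or.inl (Or.inr ⟨rfl, hi⟩)⟩

theorem adj_step (e : Edges H) (i j : Fin (t e)) (hij : (i : ℕ) + 1 = j) :
    (Subdiv H t).Adj (Sum.inr ⟨e, i⟩) (Sum.inr ⟨e, j⟩) := by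
  refine (SimpleGraph.fromRel_adj _ _ _).2 ⟨?_, Or.inl ⟨rfl, hij⟩⟩
  intro h
  have : i = j := by simpa using h
  omega

/-- A symmetric relation containing the four kinds of edges of a subdivision contains its
adjacency relation. -/
theorem adj_induction {Q : (Fin n ⊕ Σ e : Edges H, Fin (t e)) →
      (Fin n ⊕ Σ e : Edges H, Fin (t e)) → Prop}
    (symm : ∀ x y, Q x y → Q y x)
    (direct : ∀ e : Edges H, t e = 0 → Q (Sum.inl e.1.1) (Sum.inl e.1.2))
    (first : ∀ (e : Edges H) (i : Fin (t e)), (i : ℕ) = 0 →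
      Q (Sum.inl e.1.1) (Sum.inr ⟨e, i⟩))
    (last : ∀ (e : Edges H) (i : Fin (t e)), (i : ℕ) + 1 = t e →
      Q (Sum.inl e.1.2) (Sum.inr ⟨e, i⟩))
    (step : ∀ (e : Edges H) (i j : Fin (t e)), (i : ℕ) + 1 = j →
      Q (Sum.inr ⟨e, i⟩) (Sum.inr ⟨e, j⟩))
    {x y} (hxy : (Subdiv H t).Adj x y) : Q x y := by
  have key : ∀ x y, subdivRel H t x y → Q x y := by
    rintro (u | ⟨e, i⟩) (v | ⟨e', j⟩) h
    · obtain ⟨h₁, h₂⟩ := h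
      exact direct ⟨(u, v), h₁⟩ h₂
    · rcases h with ⟨rfl, h⟩ | ⟨rfl, h⟩
      · exact first _ _ h
      · exact last _ _ h
    · exact h.elim
    · obtain ⟨rfl, h⟩ := h
      exact step _ _ _ h
  rcases ((SimpleGraph.fromRel_adj _ _ _).1 hxy).2 with h | h
  · exact key _ _ h
  · exact symm _ _ (key _ _ h)

/-- Internal vertices of a subdivision have at most two neighbours. -/
theorem exists_neighbors_inr (e : Edges H) (i : Fin (t e)) :
    ∃ a b, ∀ y, (Subdiv H t).Adj (Sum.inr ⟨e, i⟩) y → y = a ∨ y = b := by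
  classical
  let a : Fin n ⊕ Σ e : Edges H, Fin (t e) :=
    if (i : ℕ) = 0 then Sum.inl e.1.1 else Sum.inr ⟨e, ⟨i - 1, by omega⟩⟩
  let b : Fin n ⊕ Σ e : Edges H, Fin (t e) :=
    if h : (i : ℕ) + 1 = t e then Sum.inl e.1.2 else Sum.inr ⟨e, ⟨i + 1, by omega⟩⟩
  refine ⟨a, b, fun y hy => ?_⟩
  have key : ∀ {x y}, (Subdiv H t).Adj x y →
      (x = Sum.inr ⟨e, i⟩ → y = a ∨ y = b) ∧ (y = Sum.inr ⟨e, i⟩ → x = a ∨ x = b) := by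
    intro x y hxy
    refine adj_induction (Q := fun x y => (x = Sum.inr ⟨e, i⟩ → y = a ∨ y = b) ∧
      (y = Sum.inr ⟨e, i⟩ → x = a ∨ x = b)) (fun x y h => h.symm) ?_ ?_ ?_ ?_ hxy
    · intro e' _
      exact ⟨fun h => (Sum.inl_ne_inr h).elim, fun h => (Sum.inl_ne_inr h).elim⟩
    · intro e' j hj
      refine ⟨fun h => (Sum.inl_ne_inr h).elim, fun h => Or.inl ?_⟩
      cases h
      simp [a, hj]
    · intro e' j hj
      refine ⟨fun h => (Sum.inl_ne_inr h).elim, fun h => Or.inr ?_⟩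
      cases h
      simp [b, hj]
    · intro e' j k hjk
      refine ⟨fun h => Or.inr ?_, fun h => Or.inl ?_⟩
      · cases h
        have : ¬ ((i : ℕ) + 1 = t e) := by omega
        simp only [b, dif_neg this]
        congr 2
        exact Fin.ext hjk.symm
      · cases h
        have : ¬ ((i : ℕ) = 0) := by omega
        simp only [a, if_neg this]
        congr 2
        exact Fin.ext (by simp; omega)
  exact (key hy).1 rfl

/-- Each edge at a branch vertex provides a neighbour determining the edge. -/
theorem exists_neighbor_inl {u v : Fin n} (huv : H.Adj u v) :
    ∃ x, (Subdiv H t).Adj (Sum.inl u) x ∧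
      (x = Sum.inl v ∨ ∃ e i, x = Sum.inr ⟨e, i⟩ ∧ (e.1 = (u, v) ∨ e.1 = (v, u))) := by
  rcases lt_or_gt_of_ne huv.ne with h | h
  · by_cases ht : t ⟨(u, v), h, huv⟩ = 0
    · exact ⟨_, adj_direct ⟨(u, v), h, huv⟩ ht, Or.inl rfl⟩
    · exact ⟨_, adj_first ⟨(u, v), h, huv⟩ ⟨0, by omega⟩ rfl, Or.inr ⟨_, _, rfl, Or.inl rfl⟩⟩
  · by_cases ht : t ⟨(v, u), h, huv.symm⟩ = 0
    · exact ⟨_, (adj_direct ⟨(v, u), h, huv.symm⟩ ht).symm, Or.inl rfl⟩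
    · exact ⟨_, adj_last ⟨(v, u), h, huv.symm⟩ ⟨t ⟨(v, u), h, huv.symm⟩ - 1, by omega⟩
        (by simp; omega), Or.inr ⟨_, _, rfl, Or.inr rfl⟩⟩

/-- A function growing by at most one along edges of a subdivision grows by at most `t e + 1`
along a subdivided edge `e`. -/
theorem le_add_of_lipschitz (g : (Fin n ⊕ Σ e : Edges H, Fin (t e)) → ℕ)
    (hg : ∀ x y, (Subdiv H t).Adj x y → g y ≤ g x + 1) (e : Edges H) :
    g (Sum.inl e.1.2) ≤ g (Sum.inl e.1.1) + t e + 1 ∧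
      g (Sum.inl e.1.1) ≤ g (Sum.inl e.1.2) + t e + 1 := by
  by_cases ht : t e = 0
  · have := adj_direct e ht
    have h₁ := hg _ _ this
    have h₂ := hg _ _ this.symm
    omega
  · have key : ∀ (i : ℕ) (hi : i < t e),
        g (Sum.inr ⟨e, ⟨i, hi⟩⟩) ≤ g (Sum.inl e.1.1) + i + 1 ∧
        g (Sum.inl e.1.1) ≤ g (Sum.inr ⟨e, ⟨i, hi⟩⟩) + i + 1 := by
      intro i
      induction i with
      | zero =>
        intro hi
        have := adj_first e ⟨0, hi⟩ rfl
        exact ⟨hg _ _ this, hg _ _ this.symm⟩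
      | succ i ih =>
        intro hi
        have := adj_step e ⟨i, by omega⟩ ⟨i + 1, hi⟩ rfl
        have h₁ := hg _ _ this
        have h₂ := hg _ _ this.symm
        have h₃ := ih (by omega)
        omega
    have h := key (t e - 1) (by omega)
    have := adj_last e ⟨t e - 1, by omega⟩ (Nat.sub_add_cancel (by omega))
    have h₁ := hg _ _ this
    have h₂ := hg _ _ this.symm
    omega

/-- A strictly monotone graph homomorphism induces an embedding of exact subdivisions as
induced subgraphs. -/
theorem isInducedSubgraphOf_of_strictMono {m p : ℕ} (hp : 1 ≤ p) {S : SimpleGraph (Fin m)}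
    (g : S →g H) (hg : StrictMono g) :
    IsInducedSubgraphOf (Subdiv S (fun _ => p)) (Subdiv H (fun _ => p)) := by
  let ge : Edges S → Edges H := fun e => ⟨(g e.1.1, g e.1.2), hg e.2.1, g.map_adj e.2.2⟩
  have hge : Function.Injective ge := by
    intro e e' h
    have h' := congrArg Subtype.val h
    have h₁ : g e.1.1 = g e'.1.1 := congrArg Prod.fst h'
    have h₂ : g e.1.2 = g e'.1.2 := congrArg Prod.snd h'
    exact Subtype.ext (Prod.ext (hg.injective h₁) (hg.injective h₂))
  let F : (Fin m ⊕ Σ _ : Edges S, Fin p) → (Fin n ⊕ Σ _ : Edges H, Fin p) :=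
    Sum.map g (Sigma.map ge fun _ => id)
  have hF : Function.Injective F :=
    hg.injective.sumMap (hge.sigma_map fun _ => Function.injective_id)
  have hrel : ∀ x y, subdivRel H (fun _ => p) (F x) (F y) ↔ subdivRel S (fun _ => p) x y := by
    rintro (u | ⟨e, i⟩) (v | ⟨e', j⟩)
    · constructor
      · rintro ⟨_, h⟩
        exact absurd h (Nat.one_le_iff_ne_zero.1 hp)
      · rintro ⟨_, h⟩
        exact absurd h (Nat.one_le_iff_ne_zero.1 hp)
    · change (g u = g e'.1.1 ∧ _ ∨ g u = g e'.1.2 ∧ _) ↔ (u = e'.1.1 ∧ _ ∨ u = e'.1.2 ∧ _)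
      rw [hg.injective.eq_iff, hg.injective.eq_iff]
      rfl
    · exact Iff.rfl
    · change (ge e = ge e' ∧ _) ↔ (e = e' ∧ _)
      rw [hge.eq_iff]
      rfl
  refine ⟨⟨⟨F, hF⟩, ?_⟩⟩
  intro x y
  change (SimpleGraph.fromRel _).Adj (F x) (F y) ↔ (SimpleGraph.fromRel _).Adj x y
  rw [SimpleGraph.fromRel_adj, SimpleGraph.fromRel_adj, hrel, hrel, hF.ne_iff]

/-- Branch vertices of an exact `p`-subdivision that are nonadjacent in the original graph are
separated by a `1`-Lipschitz function taking the values `0` and `p + 2`. -/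
theorem exists_separating_lipschitz {p : ℕ} (u : Fin n) :
    ∃ g : (Fin n ⊕ Σ _ : Edges H, Fin p) → ℕ,
      (∀ x y, (Subdiv H fun _ => p).Adj x y → g y ≤ g x + 1) ∧ g (Sum.inl u) = 0 ∧
      ∀ v, v ≠ u → ¬ H.Adj u v → g (Sum.inl v) = p + 2 := by
  classical
  let g : (Fin n ⊕ Σ _ : Edges H, Fin p) → ℕ :=
    Sum.elim (fun w => if w = u then 0 else if H.Adj u w then p + 1 else p + 2)
      (fun x => if x.1.1.1 = u then x.2 + 1 else if x.1.1.2 = u then p - x.2 else p + 1)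
  refine ⟨g, fun x y hxy => ?_, by simp [g], fun v hv huv => by simp [g, hv, huv]⟩
  refine (adj_induction (Q := fun x y => g y ≤ g x + 1 ∧ g x ≤ g y + 1)
    (fun x y h => h.symm) ?_ ?_ ?_ ?_ hxy).1
  · rintro ⟨⟨a, b⟩, hab, hH⟩ h
    have hne := hab.ne
    simp only [g, Sum.elim_inl]
    by_cases ha : a = u
    · subst ha
      simp [hne.symm, hH]
      omega
    · by_cases hb : b = u
      · subst hb
        simp [hne, hH.symm]
        omega
      · simp only [ha, hb, if_false]
        split_ifs <;> omega
  · rintro ⟨⟨a, b⟩, hab, hH⟩ ⟨i, hip⟩ hi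
    have hne := hab.ne
    simp only [g, Sum.elim_inl, Sum.elim_inr]
    simp only at hi hip
    by_cases ha : a = u
    · subst ha
      simp
      omega
    · by_cases hb : b = u
      · subst hb
        simp [hne, hH.symm]
        omega
      · simp only [ha, hb, if_false]
        split_ifs <;> omega
  · rintro ⟨⟨a, b⟩, hab, hH⟩ ⟨i, hip⟩ hi
    have hne := hab.ne
    simp only [g, Sum.elim_inl, Sum.elim_inr]
    simp only at hi hip
    by_cases ha : a = u
    · subst ha
      simp [hne.symm, hH]
      omega
    · by_cases hb : b = u
      · subst hb
        simp [hne]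
        omega
      · simp only [ha, hb, if_false]
        split_ifs <;> omega
  · rintro ⟨⟨a, b⟩, hab, hH⟩ ⟨i, hip⟩ ⟨j, hjp⟩ hi
    simp only [g, Sum.elim_inr]
    simp only at hi hip hjp
    split_ifs <;> omega

end Subdiv

/-! ## Clique numbers -/

theorem isSubgraphOf_top_le {m n : ℕ} {H : SimpleGraph (Fin n)}
    (h : IsSubgraphOf (⊤ : SimpleGraph (Fin m)) H) : m ≤ n := by
  obtain ⟨g, hg⟩ := h
  simpa using Fintype.card_le_of_injective g hg

theorem le_omegaNum {m n : ℕ} {H : SimpleGraph (Fin n)}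
    (h : IsSubgraphOf (⊤ : SimpleGraph (Fin m)) H) : m ≤ omegaNum H :=
  le_csSup ⟨n, fun _ hk => isSubgraphOf_top_le hk⟩ h

theorem isSubgraphOf_top_omegaNum {n : ℕ} (H : SimpleGraph (Fin n)) :
    IsSubgraphOf (⊤ : SimpleGraph (Fin (omegaNum H))) H := by
  refine Nat.sSup_mem (s := {m | IsSubgraphOf (⊤ : SimpleGraph (Fin m)) H}) ⟨0, ?_⟩
    ⟨n, fun _ hk => isSubgraphOf_top_le hk⟩
  exact ⟨⟨fun i => i.elim0, fun {i} => i.elim0⟩, fun i => i.elim0⟩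

/-- The topological clique number of the exact `p`-subdivision of `H`, at depth `p`, is bounded
by the clique number of `H`. -/
theorem omegaNum_le_of_memTM_subdiv {n k p : ℕ} {H : SimpleGraph (Fin n)}
    {H' : SimpleGraph (Fin k)} (h : MemTM p (Subdiv H fun _ => p) H') :
    omegaNum H' ≤ max 3 (omegaNum H) := by
  classical
  obtain ⟨t, ht, F, hF⟩ := h
  obtain ⟨a, ha⟩ := isSubgraphOf_top_omegaNum H'
  by_cases h3 : omegaNum H' ≤ 3
  · exact le_max_of_le_left h3
  refine le_max_of_le_right ?_
  have hinl : ∀ i, ∃ w, F (Sum.inl (a i)) = Sum.inl w := by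
    intro i
    rcases hx : F (Sum.inl (a i)) with w | ⟨e, q⟩
    · exact ⟨w, rfl⟩
    exfalso
    obtain ⟨y, z, hyz⟩ := Subdiv.exists_neighbors_inr (t := fun _ => p) e q
    have hnb : ∀ j, j ≠ i → ∃ x, (Subdiv H' t).Adj (Sum.inl (a i)) x ∧
        (x = Sum.inl (a j) ∨ ∃ e i', x = Sum.inr ⟨e, i'⟩ ∧
          (e.1 = (a i, a j) ∨ e.1 = (a j, a i))) :=
      fun j hj => Subdiv.exists_neighbor_inl (a.map_adj (by simpa using hj.symm))
    have : Nonempty (Fin k ⊕ Σ e : Edges H', Fin (t e)) := ⟨Sum.inl (a i)⟩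
    choose! x hx₁ hx₂ using hnb
    have hxinj : ∀ j j', j ≠ i → j' ≠ i → x j = x j' → j = j' := by
      intro j j' hj hj' hjj
      apply ha
      have hai : a j ≠ a i := fun h => hj (ha h)
      have hai' : a j' ≠ a i := fun h => hj' (ha h)
      rcases hx₂ j hj with h₁ | ⟨e₁, i₁, h₁, h₁'⟩ <;>
        rcases hx₂ j' hj' with h₂ | ⟨e₂, i₂, h₂, h₂'⟩ <;> rw [hjj, h₂] at h₁
      · exact (Sum.inl.inj h₁).symm
      · cases h₁
      · cases h₁
      · cases h₁
        rcases h₁' with h | h <;> rcases h₂' with h' | h' <;> rw [h] at h' <;>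
          simp only [Prod.mk.injEq] at h'
        · exact h'.2
        · exact (hai' h'.1.symm).elim
        · exact (hai h'.1).elim
        · exact h'.1
    have hsub : (Finset.univ.erase i).image (fun j => F (x j)) ⊆ {y, z} := by
      intro w hw
      obtain ⟨j, hj, rfl⟩ := Finset.mem_image.1 hw
      have := F.map_adj (hx₁ j (Finset.ne_of_mem_erase hj))
      rw [hx] at this
      simpa using hyz _ this
    have hcard := Finset.card_le_card hsub
    rw [Finset.card_image_of_injOn, Finset.card_erase_of_mem (Finset.mem_univ _),
      Finset.card_univ, Fintype.card_fin] at hcard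
    · have := Finset.card_le_two (a := y) (b := z)
      omega
    · intro j hj j' hj' hjj
      exact hxinj j j' (Finset.ne_of_mem_erase hj) (Finset.ne_of_mem_erase hj') (hF hjj)
  choose b hb using hinl
  have hbinj : Function.Injective b := by
    intro i j hij
    apply ha
    apply Sum.inl_injective
    apply hF
    rw [hb, hb, hij]
  refine le_omegaNum ⟨⟨b, fun {i j} hij => ?_⟩, hbinj⟩
  by_contra hnadj
  obtain ⟨g, hg, hg0, hgv⟩ := Subdiv.exists_separating_lipschitz (H := H) (p := p) (b i)
  have hgj := hgv (b j) (fun h => hij.ne (hbinj h).symm) hnadj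
  have hlip := Subdiv.le_add_of_lipschitz (fun x => g (F x))
    (fun x y hxy => hg _ _ (F.map_adj hxy))
  rw [← hb] at hg0 hgj
  have hadj : H'.Adj (a i) (a j) := a.map_adj hij
  rcases lt_or_gt_of_ne hadj.ne with h | h
  · have h₁ := (hlip ⟨(a i, a j), h, hadj⟩).1
    have h₂ := ht ⟨(a i, a j), h, hadj⟩
    simp only at h₁
    omega
  · have h₁ := (hlip ⟨(a j, a i), h, hadj.symm⟩).2
    have h₂ := ht ⟨(a j, a i), h, hadj.symm⟩
    simp only at h₁
    omega

/-! ## Coloring a graph from a coloring of its subdivision -/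

theorem colorable_of_subdiv {n p N : ℕ} {H : SimpleGraph (Fin n)} (hp : 1 ≤ p)
    (c : (Fin n ⊕ Σ _ : Edges H, Fin p) → Fin N)
    (hc : ∀ I : Finset (Fin N), I.card ≤ p + 1 →
      TreeDepthLE ((Subdiv H fun _ => p).induce {x | c x ∈ I}) I.card) :
    H.Colorable (N * (p + 2) ^ 2 ^ N) := by
  classical
  let E : Finset (Fin N) → Edges H → Prop := fun I e =>
    c (Sum.inl e.1.1) ∈ I ∧ c (Sum.inl e.1.2) ∈ I ∧ ∀ i, c (Sum.inr ⟨e, i⟩) ∈ I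
  let HI : Finset (Fin N) → SimpleGraph (Fin n) := fun I =>
    SimpleGraph.fromRel fun u v => ∃ e : Edges H, e.1 = (u, v) ∧ E I e
  let B : Finset (Fin N) → Fin n → Set (Fin n ⊕ Σ _ : Edges H, Fin p) := fun I u =>
    {x | (x = Sum.inl u ∧ c x ∈ I) ∨ ∃ e i, x = Sum.inr ⟨e, i⟩ ∧ e.1.1 = u ∧ E I e}
  have hcol : ∀ I : Finset (Fin N), I.card ≤ p + 1 → (HI I).Colorable (p + 2) := by
    intro I hI
    have hedge : ∀ u v, (∃ e : Edges H, e.1 = (u, v) ∧ E I e) →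
        ∃ a ∈ B I u, ∃ b ∈ B I v, (Subdiv H fun _ => p).Adj a b := by
      rintro u v ⟨e, he, hE⟩
      obtain ⟨h₁, h₂⟩ := Prod.ext_iff.1 he
      simp only at h₁ h₂
      subst h₁ h₂
      exact ⟨Sum.inr ⟨e, ⟨p - 1, by omega⟩⟩, Or.inr ⟨e, _, rfl, rfl, hE⟩, Sum.inl e.1.2,
        Or.inl ⟨rfl, hE.2.1⟩, (Subdiv.adj_last e _ (by simp; omega)).symm⟩
    refine ((hc I hI).colorable_of_minor (HI I) (B I) ?_ ?_ ?_ ?_).mono (by omega)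
    · rintro u x (⟨rfl, h⟩ | ⟨e, i, rfl, rfl, h⟩)
      · exact h
      · exact h.2.2 i
    · rintro u v x (⟨rfl, h⟩ | ⟨e, i, rfl, rfl, h⟩) (⟨h₁, h'⟩ | ⟨e', i', h₁, rfl, h'⟩)
      · exact Sum.inl.inj h₁
      · cases h₁
      · cases h₁
      · cases h₁
        rfl
    · intro u P hP
      have hiff : ∀ e : Edges H, e.1.1 = u → E I e → ∀ i : ℕ, ∀ hi : i < p,
          (P (Sum.inl u) ↔ P (Sum.inr ⟨e, ⟨i, hi⟩⟩)) := by
        rintro e rfl he i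
        have hmem : ∀ i, Sum.inr ⟨e, i⟩ ∈ B I e.1.1 := fun i => Or.inr ⟨e, i, rfl, rfl, he⟩
        have hctr : Sum.inl e.1.1 ∈ B I e.1.1 := Or.inl ⟨rfl, he.1⟩
        induction i with
        | zero =>
          intro hi
          have := Subdiv.adj_first (t := fun _ => p) e ⟨0, hi⟩ rfl
          exact ⟨hP _ hctr _ (hmem _) this, hP _ (hmem _) _ hctr this.symm⟩
        | succ i ih =>
          intro hi
          have := Subdiv.adj_step (t := fun _ => p) e ⟨i, by omega⟩ ⟨i + 1, hi⟩ rfl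
          exact (ih (by omega)).trans
            ⟨hP _ (hmem _) _ (hmem _) this, hP _ (hmem _) _ (hmem _) this.symm⟩
      have hall : ∀ x ∈ B I u, (P (Sum.inl u) ↔ P x) := by
        rintro x (⟨rfl, h⟩ | ⟨e, i, rfl, h, h'⟩)
        · rfl
        · exact hiff e h h' i i.2
      exact fun x hx hPx y hy => (hall y hy).1 ((hall x hx).2 hPx)
    · intro u v huv
      rcases ((SimpleGraph.fromRel_adj _ _ _).1 huv).2 with h | h
      · exact hedge u v h
      · obtain ⟨a, ha, b, hb, hab⟩ := hedge v u h
        exact ⟨b, hb, a, ha, hab.symm⟩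
  have hcol' : ∀ I : Finset (Fin N), ∃ d : Fin n → Fin (p + 2), I.card ≤ p + 1 →
      ∀ u v, (HI I).Adj u v → d u ≠ d v := by
    intro I
    by_cases hI : I.card ≤ p + 1
    · obtain ⟨d⟩ := hcol I hI
      exact ⟨d, fun _ u v huv => d.valid huv⟩
    · exact ⟨fun _ => 0, fun h => (hI h).elim⟩
  choose d hd using hcol'
  have hedge : ∀ e : Edges H, c (Sum.inl e.1.1) = c (Sum.inl e.1.2) →
      ∃ I : Finset (Fin N), d I e.1.1 ≠ d I e.1.2 := by
    intro e he
    refine ⟨insert (c (Sum.inl e.1.1)) (Finset.univ.image fun i => c (Sum.inr ⟨e, i⟩)),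
      hd _ ?_ _ _ ?_⟩
    · refine (Finset.card_insert_le _ _).trans (Nat.succ_le_succ ?_)
      exact Finset.card_image_le.trans (by simp)
    · refine (SimpleGraph.fromRel_adj _ _ _).2 ⟨e.2.1.ne, Or.inl ⟨e, rfl, ?_, ?_, ?_⟩⟩
      · exact Finset.mem_insert_self _ _
      · rw [← he]
        exact Finset.mem_insert_self _ _
      · exact fun i => Finset.mem_insert_of_mem (Finset.mem_image_of_mem _ (Finset.mem_univ i))
  let col : H.Coloring (Fin N × (Finset (Fin N) → Fin (p + 2))) :=
    Coloring.mk (fun u => (c (Sum.inl u), fun I => d I u)) (by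
      intro u v huv heq
      obtain ⟨h₁, h₂⟩ := Prod.ext_iff.1 heq
      simp only at h₁ h₂
      rcases lt_or_gt_of_ne huv.ne with h | h
      · obtain ⟨I, hI⟩ := hedge ⟨(u, v), h, huv⟩ h₁
        exact hI (congrFun h₂ I)
      · obtain ⟨I, hI⟩ := hedge ⟨(v, u), h, huv.symm⟩ h₁.symm
        exact hI (congrFun h₂ I).symm)
  simpa using col.colorable

theorem chi_le_of_colorable {V : Type*} {G : SimpleGraph V} {N : ℕ} (h : G.Colorable N) :
    chi G ≤ N :=
  Nat.sInf_le h

/-! ## Triangle-free graphs of large chromatic number -/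

/-- The shift graph on pairs: `(i, j)` and `(j, k)` are adjacent whenever `i < j < k`. -/
def shiftGraph (n : ℕ) : SimpleGraph (Fin n × Fin n) :=
  SimpleGraph.fromRel fun x y => x.1 < x.2 ∧ y.1 < y.2 ∧ x.2 = y.1

theorem shiftGraph_not_triangle {n : ℕ} {x y z : Fin n × Fin n} (hxy : (shiftGraph n).Adj x y)
    (hyz : (shiftGraph n).Adj y z) (hxz : (shiftGraph n).Adj x z) : False := by
  have h₁ := ((SimpleGraph.fromRel_adj _ _ _).1 hxy).2
  have h₂ := ((SimpleGraph.fromRel_adj _ _ _).1 hyz).2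
  have h₃ := ((SimpleGraph.fromRel_adj _ _ _).1 hxz).2
  omega

theorem le_of_shiftGraph_colorable {n N : ℕ} (h : (shiftGraph n).Colorable N) : n ≤ 2 ^ N := by
  classical
  obtain ⟨c⟩ := h
  let A : Fin n → Finset (Fin N) := fun i =>
    (Finset.univ.filter fun j => i < j).image fun j => c (i, j)
  have hA : ∀ i j, i < j → A i ≠ A j := by
    intro i j hij heq
    have hmem : c (i, j) ∈ A i :=
      Finset.mem_image_of_mem _ (Finset.mem_filter.2 ⟨Finset.mem_univ _, hij⟩)
    rw [heq] at hmem
    obtain ⟨k, hk, hck⟩ := Finset.mem_image.1 hmem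
    have hjk := (Finset.mem_filter.1 hk).2
    refine c.valid (v := (i, j)) (w := (j, k)) ?_ hck.symm
    refine (SimpleGraph.fromRel_adj _ _ _).2 ⟨?_, Or.inl ⟨hij, hjk, rfl⟩⟩
    intro h
    exact hij.ne (Prod.ext_iff.1 h).1
  have hinj : Function.Injective A := by
    intro i j hij
    by_contra hne
    rcases lt_or_gt_of_ne hne with h | h
    · exact hA i j h hij
    · exact hA j i h hij.symm
  simpa using Fintype.card_le_of_injective A hinj

theorem exists_omegaNum_le_two_chi_gt (N : ℕ) :
    ∃ (k : ℕ) (S : SimpleGraph (Fin k)), omegaNum S ≤ 2 ∧ N < chi S := by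
  let n := 2 ^ N + 1
  let S : SimpleGraph (Fin (n * n)) := (shiftGraph n).comap finProdFinEquiv.symm
  refine ⟨n * n, S, ?_, ?_⟩
  · by_contra! h
    obtain ⟨g, -⟩ := isSubgraphOf_top_omegaNum S
    have hadj : ∀ i j : Fin (omegaNum S), i ≠ j →
        (shiftGraph n).Adj (finProdFinEquiv.symm (g i)) (finProdFinEquiv.symm (g j)) :=
      fun i j hij => g.map_adj hij
    exact shiftGraph_not_triangle
      (hadj ⟨0, by omega⟩ ⟨1, by omega⟩ (by simp))
      (hadj ⟨1, by omega⟩ ⟨2, by omega⟩ (by simp))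
      (hadj ⟨0, by omega⟩ ⟨2, by omega⟩ (by simp))
  · by_contra! h
    have hS : S.Colorable (chi S) :=
      Nat.sInf_mem (s := {N | S.Colorable N}) ⟨n * n, by simpa using S.colorable_of_fintype⟩
    obtain ⟨c⟩ := hS.mono h
    have hc : (shiftGraph n).Colorable N :=
      ⟨Coloring.mk (fun x => c (finProdFinEquiv x)) fun {x y} hxy =>
        c.valid (by simpa [S] using hxy)⟩
    have := le_of_shiftGraph_colorable hc
    omega

/-! ## Exact subdivisions in hereditary classes -/

/-- Monotonicity of `ITM_p^e(𝒞)` for graphs that fit inside a clique. -/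
theorem MemITMClass.of_clique {C : GraphClass} {p m k : ℕ} (hp : 1 ≤ p)
    {H : SimpleGraph (Fin m)} (hH : MemITMClass p C H) (hk : k ≤ omegaNum H)
    (S : SimpleGraph (Fin k)) : MemITMClass p C S := by
  classical
  obtain ⟨n, G, hG, ⟨φ⟩⟩ := hH
  obtain ⟨g, hg⟩ := isSubgraphOf_top_omegaNum H
  let s : Finset (Fin m) := Finset.univ.image fun i => g (Fin.castLE hk i)
  have hs : s.card = k := by
    exact (Finset.card_image_of_injective _ (hg.comp (Fin.castLE_injective hk))).trans (by simp)
  let o := s.orderEmbOfFin hs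
  have ho : ∀ i j, i ≠ j → H.Adj (o i) (o j) := by
    intro i j hij
    obtain ⟨a, -, ha⟩ := Finset.mem_image.1 (s.orderEmbOfFin_mem hs i)
    obtain ⟨b, -, hb⟩ := Finset.mem_image.1 (s.orderEmbOfFin_mem hs j)
    change H.Adj (s.orderEmbOfFin hs i) (s.orderEmbOfFin hs j)
    have hne : s.orderEmbOfFin hs i ≠ s.orderEmbOfFin hs j :=
      fun h => hij ((s.orderEmbOfFin hs).injective h)
    rw [← ha, ← hb] at hne ⊢
    exact g.map_adj (fun h => hne (congrArg g h))
  let oh : S →g H := ⟨o, fun {i j} hij => ho i j hij.ne⟩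
  obtain ⟨ψ⟩ := Subdiv.isInducedSubgraphOf_of_strictMono hp oh o.strictMono
  exact ⟨n, G, hG, ⟨φ.comp ψ⟩⟩

theorem exists_chi_le_of_memITMClass (C : GraphClass) (hC : Hereditary C) (p : ℕ) (hp : 1 ≤ p)
    (f : ℕ → ℕ)
    (hf : ∀ ⦃n : ℕ⦄ (G : SimpleGraph (Fin n)), G ∈ C n → chiP G (p + 1) ≤ f (omegaTM p G))
    {m : ℕ} (H : SimpleGraph (Fin m)) (hH : MemITMClass p C H) :
    ∃ w ≤ max 3 (omegaNum H), chi H ≤ f w * (p + 2) ^ 2 ^ f w := by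
  obtain ⟨n, G, hG, ⟨φ⟩⟩ := hH
  obtain ⟨M, ⟨e⟩⟩ := Finite.exists_equiv_fin (Fin m ⊕ Σ _ : Edges H, Fin p)
  let G' : SimpleGraph (Fin M) := (Subdiv H fun _ => p).comap e.symm
  let ι : G' ≃g Subdiv H fun _ => p := ⟨e.symm, Iff.rfl⟩
  have hG' : G' ∈ C M := hC G G' hG ⟨φ.comp ι.toEmbedding⟩
  refine ⟨omegaTM p G', ?_, ?_⟩
  · refine csSup_le' ?_
    rintro _ ⟨k, H', ⟨t, ht, F, hF⟩, rfl⟩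
    exact omegaNum_le_of_memTM_subdiv
      ⟨t, ht, ι.toEmbedding.toHom.comp F, ι.injective.comp hF⟩
  · have hle := hf G' hG'
    obtain ⟨c, hc⟩ := exists_coloring_chiP G' (p + 1)
    have hcol : H.Colorable (chiP G' (p + 1) * (p + 2) ^ 2 ^ chiP G' (p + 1)) := by
      refine colorable_of_subdiv hp (fun x => c (e x)) fun I hI => ?_
      refine (hc I hI).of_injective_hom ⟨fun x => ⟨e x.1, x.2⟩, fun {x y} hxy => ?_⟩ ?_
      · change (Subdiv H fun _ => p).Adj (e.symm (e x.1)) (e.symm (e y.1))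
        rw [e.symm_apply_apply, e.symm_apply_apply]
        exact hxy
      · intro x y hxy
        exact Subtype.ext (e.injective (congrArg Subtype.val hxy))
    refine (chi_le_of_colorable hcol).trans ?_
    gcongr
    · omega
    · norm_num

/-- If `𝒞` is hereditary and `χ_{p+1}(G) ≤ f(ω(TM_p(G)))` for all `G ∈ 𝒞`,
then the chromatic numbers of the graphs of `ITM_p^e(𝒞)` are bounded. -/
theorem itm_chi_bdd (C : GraphClass) (hC : Hereditary C) (p : ℕ) (hp : 1 ≤ p)
    (f : ℕ → ℕ)
    (hf : ∀ ⦃n : ℕ⦄ (G : SimpleGraph (Fin n)), G ∈ C n →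
      chiP G (p + 1) ≤ f (omegaTM p G)) :
    ∃ c : ℕ, ∀ ⦃m : ℕ⦄ (H : SimpleGraph (Fin m)), MemITMClass p C H → chi H ≤ c := by
  let Φ : ℕ → ℕ := fun w =>
    (Finset.range (max 3 w + 1)).sup fun k => f k * (p + 2) ^ 2 ^ f k
  have hΦ : ∀ ⦃m : ℕ⦄ (H : SimpleGraph (Fin m)) (w : ℕ), MemITMClass p C H →
      omegaNum H ≤ w → chi H ≤ Φ w := by
    intro m H w hH hw
    obtain ⟨k, hk, hle⟩ := exists_chi_le_of_memITMClass C hC p hp f hf H hH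
    refine hle.trans (Finset.le_sup (f := fun k => f k * (p + 2) ^ 2 ^ f k)
      (Finset.mem_range.2 ?_))
    omega
  obtain ⟨k, S, hS, hchi⟩ := exists_omegaNum_le_two_chi_gt (Φ 2)
  refine ⟨Φ k, fun m H hH => hΦ H k hH ?_⟩
  by_contra! hk
  exact absurd (hΦ S 2 (hH.of_clique hp hk.le S) hS) (by omega)
end
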